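/- Assume the standing setup, let E be the number of U-rich directions, let W be the total number of U-rich lines, and define f(T) := (p - r/2 - 1/2)·T² - (n - 1)·(p - r/2 - 1/2)·T - p·(p - r)·T - N·T for T ∈ ℚ. Then Σ_{m U-rich} c_m ≤ ((n - 1)·N·E + (2p - r - 1)·N + f(W))/2, where the sum runs over all U-rich directions m (inequality in ℚ). -/

import Mathlib

open Finset Polynomial

attribute [local instance] Classical.propDecidable

/-- The line in `(ZMod p)²` with slope `m` (where `none` denotes the vertical
slope `∞`) and "intercept" `c`. -/
noncomputable def lineWithSlope (p : ℕ) [NeZero p] (m : Option (ZMod p)) (c : ZMod p) :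
    Finset (ZMod p × ZMod p) :=
  match m with
  | some m => Finset.univ.filter fun q => q.2 = m * q.1 + c
  | none => Finset.univ.filter fun q => q.1 = c

/-- `ℓ` is `U`-rich: it meets `U` in at least `#U/p + 1` points. -/
def IsRich (p : ℕ) (U ℓ : Finset (ZMod p × ZMod p)) : Prop :=
  (U.card : ℚ) / p + 1 ≤ ((ℓ ∩ U).card : ℚ)

/-- `ℓ` is `U`-poor: it meets `U` in at most `#U/p - 1` points. -/
def IsPoor (p : ℕ) (U ℓ : Finset (ZMod p × ZMod p)) : Prop :=
  ((ℓ ∩ U).card : ℚ) ≤ (U.card : ℚ) / p - 1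

/-- `m` is a `U`-rich direction: some line with slope `m` is `U`-rich. -/
def IsRichDir (p : ℕ) [NeZero p] (U : Finset (ZMod p × ZMod p))
    (m : Option (ZMod p)) : Prop :=
  ∃ c : ZMod p, IsRich p U (lineWithSlope p m c)

/-- `m` is a `U`-special direction: some line with slope `m` is `U`-rich or `U`-poor. -/
def IsSpecialDir (p : ℕ) [NeZero p] (U : Finset (ZMod p × ZMod p))
    (m : Option (ZMod p)) : Prop :=
  ∃ c : ZMod p, IsRich p U (lineWithSlope p m c) ∨ IsPoor p U (lineWithSlope p m c)

/-- `c_m`: the number of unordered pairs of distinct points of `U` lying on a common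
line with slope `m`. -/
noncomputable def pairsCount (p : ℕ) [NeZero p] (U : Finset (ZMod p × ZMod p))
    (m : Option (ZMod p)) : ℕ :=
  ((U.powersetCard 2).filter fun s => ∃ c : ZMod p, s ⊆ lineWithSlope p m c).card

/-- The set of `U`-rich lines, identified with pairs (slope, intercept). -/
noncomputable def richLines (p : ℕ) [NeZero p] (U : Finset (ZMod p × ZMod p)) :
    Finset (Option (ZMod p) × ZMod p) :=
  Finset.univ.filter fun q => IsRich p U (lineWithSlope p q.1 q.2)

/-- The set of `U`-rich directions, as a finset. -/
noncomputable def richDirs (p : ℕ) [NeZero p] (U : Finset (ZMod p × ZMod p)) :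
    Finset (Option (ZMod p)) :=
  Finset.univ.filter fun m => IsRichDir p U m

/-- `w_m`: the number of `U`-rich lines with slope `m`. -/
noncomputable def wSlope (p : ℕ) [NeZero p] (U : Finset (ZMod p × ZMod p))
    (m : Option (ZMod p)) : ℕ :=
  (Finset.univ.filter fun c : ZMod p => IsRich p U (lineWithSlope p m c)).card

/-- Every monomial `Yⁱ Xʲ` of `P`, with `Y` of weight `d` and `X` of weight `1`, has weight at
most `K`. -/
def WeightLE {A : Type*} [CommRing A] (d K : ℕ) (P : A[X][X]) : Prop :=
  ∀ i j, K < i * d + j → (P.coeff i).coeff j = 0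

namespace WeightLE

variable {A : Type*} [CommRing A] {d K L : ℕ} {P Q : A[X][X]}

lemma mono (hP : WeightLE d K P) (h : K ≤ L) : WeightLE d L P :=
  fun i j hij => hP i j (h.trans_lt hij)

lemma add (hP : WeightLE d K P) (hQ : WeightLE d K Q) : WeightLE d K (P + Q) := by
  intro i j h
  simp [hP i j h, hQ i j h]

lemma sub (hP : WeightLE d K P) (hQ : WeightLE d K Q) : WeightLE d K (P - Q) := by
  intro i j h
  simp [hP i j h, hQ i j h]

lemma mul (hP : WeightLE d K P) (hQ : WeightLE d L Q) : WeightLE d (K + L) (P * Q) := by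
  intro i j h
  rw [coeff_mul, finsetSum_coeff]
  refine Finset.sum_eq_zero fun x hx => ?_
  rw [coeff_mul]
  refine Finset.sum_eq_zero fun y hy => ?_
  rw [HasAntidiagonal.mem_antidiagonal] at hx hy
  by_cases h1 : K < x.1 * d + y.1
  · rw [hP _ _ h1, zero_mul]
  · rw [hQ x.2 y.2 (by rw [← hx, ← hy, add_mul] at h; omega), mul_zero]

lemma of_C_mul_X_pow {a : A[X]} {i : ℕ} (h : ∀ j, K < i * d + j → a.coeff j = 0) :
    WeightLE d K (C a * X ^ i) := by
  intro i' j hij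
  rw [coeff_C_mul_X_pow]
  split_ifs with hi
  · subst hi; exact h j hij
  · simp

lemma of_C {a : A[X]} (h : ∀ j, K < j → a.coeff j = 0) : WeightLE d K (C a) := by
  have := of_C_mul_X_pow (d := d) (K := K) (a := a) (i := 0) (by simpa using h)
  simpa using this

lemma of_X_pow (i : ℕ) : WeightLE (A := A) d (i * d) (X ^ i) := by
  have := of_C_mul_X_pow (d := d) (K := i * d) (a := (1 : A[X])) (i := i) (by
    intro j hj
    rw [coeff_one, if_neg (by omega)])
  simpa using this

lemma of_X : WeightLE (A := A) d d X := by
  simpa using of_X_pow (A := A) (d := d) 1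

lemma prod {ι : Type*} (s : Finset ι) (f : ι → A[X][X]) (w : ℕ)
    (h : ∀ i ∈ s, WeightLE d w (f i)) : WeightLE d (#s * w) (∏ i ∈ s, f i) := by
  induction s using Finset.induction_on with
  | empty => simpa using of_X_pow (A := A) (d := d) 0
  | insert a s ha ih =>
    rw [prod_insert ha, card_insert_of_notMem ha]
    refine ((h a (mem_insert_self _ _)).mul
      (ih fun i hi => h i (mem_insert_of_mem hi))).mono ?_
    rw [add_mul]; omega

lemma coeff_eq_zero (hP : WeightLE d K P) {i : ℕ} (h : K < i * d) : P.coeff i = 0 := by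
  ext j
  rw [hP i j (by omega), coeff_zero]

lemma natDegree_coeff_le (hP : WeightLE d K P) (i : ℕ) : (P.coeff i).natDegree ≤ K - i * d := by
  rw [natDegree_le_iff_coeff_eq_zero]
  intro j hj
  exact hP i j (by omega)

/-- Division by a monic polynomial of the expected weight respects weights. -/
lemma divMod_byMonic [Nontrivial A] {H : A[X][X]} {N : ℕ} (hH : H.Monic) (hN : H.natDegree = N)
    (hHw : WeightLE 1 N H) (hNK : N ≤ K) (hP : WeightLE 1 K P) :
    WeightLE 1 (K - N) (P /ₘ H) ∧ WeightLE 1 K (P %ₘ H) := by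
  suffices h : ∀ k, ∀ P : A[X][X], (∀ i, k + N ≤ i → P.coeff i = 0) → WeightLE 1 K P →
      ∃ q R, R + H * q = P ∧ R.degree < H.degree ∧ WeightLE 1 (K - N) q by
    obtain ⟨q, R, h1, h2, h3⟩ := h (P.natDegree + 1) P
      (fun i hi => coeff_eq_zero_of_natDegree_lt (by omega)) hP
    obtain ⟨hq, hR⟩ := div_modByMonic_unique q R hH ⟨h1, h2⟩
    rw [hq, hR]
    refine ⟨h3, ?_⟩
    rw [eq_sub_of_add_eq h1]
    exact hP.sub ((hHw.mul h3).mono (by omega))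
  intro k
  induction k with
  | zero =>
    intro P hd _
    refine ⟨0, P, by simp, ?_, by intro i j _; simp⟩
    rw [degree_eq_natDegree hH.ne_zero, hN]
    exact (degree_lt_iff_coeff_zero _ _).2 fun m hm => hd m (by omega)
  | succ k ih =>
    intro P hd hPw
    set a := P.coeff (k + N)
    have ha : WeightLE 1 (K - N) (C a * X ^ k) :=
      of_C_mul_X_pow fun j hj => hPw _ _ (by omega)
    have hcoef : ∀ i, k + N < i → (C a * X ^ k * H).coeff i = 0 := by
      intro i hi
      refine coeff_eq_zero_of_natDegree_lt ?_
      have h1 := natDegree_mul_le (p := C a * X ^ k) (q := H)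
      have h2 := natDegree_C_mul_X_pow_le a k
      omega
    have htop : (C a * X ^ k * H).coeff (k + N) = a := by
      rw [mul_assoc, coeff_C_mul, add_comm, coeff_X_pow_mul, ← hN, hH.coeff_natDegree, mul_one]
    obtain ⟨q, R, h1, h2, h3⟩ := ih (P - C a * X ^ k * H) (by
        intro i hi
        rcases hi.eq_or_lt with rfl | hi
        · rw [coeff_sub, htop]; exact sub_self _
        · rw [coeff_sub, hcoef i hi, hd i (by omega), sub_zero])
      (hPw.sub ((ha.mul hHw).mono (by omega)))
    refine ⟨q + C a * X ^ k, R, ?_, h2, h3.add ha⟩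
    rw [mul_add, ← add_assoc, h1]; ring

end WeightLE

section Curve

variable {p : ℕ} [Fact p.Prime]

lemma coeff_eval_X_pow {C : (ZMod p)[X][X]} (hC : ∀ i, (C.coeff i).natDegree < p) (i : ℕ)
    {j : ℕ} (hj : j < p) : (C.eval (X ^ p)).coeff (p * i + j) = (C.coeff i).coeff j := by
  rw [eval_eq_sum_range, finsetSum_coeff]
  simp_rw [← pow_mul, coeff_mul_X_pow']
  rw [Finset.sum_eq_single i]
  · rw [if_pos (by omega), Nat.add_sub_cancel_left]
  · intro k _ hk
    split_ifs with h
    · have hki : k < i := by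
        have : p * k < p * (i + 1) := by rw [mul_add]; omega
        have := Nat.lt_of_mul_lt_mul_left this
        omega
      have : p * (k + 1) ≤ p * i := Nat.mul_le_mul_left _ hki
      refine coeff_eq_zero_of_natDegree_lt ((hC k).trans_le ?_)
      rw [mul_add] at this
      omega
    · rfl
  · intro h
    have : C.coeff i = 0 := coeff_eq_zero_of_natDegree_lt (by simpa using h)
    simp [this]

lemma X_pow_sub_C_eq (a : ZMod p) : (X ^ p - C a : (ZMod p)[X]) = (X - C a) ^ p := by
  rw [sub_pow_char, ← C_pow, ZMod.pow_card]

lemma rootMultiplicity_X_pow_sub_X (c : ZMod p) :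
    rootMultiplicity c (X ^ p - X : (ZMod p)[X]) = 1 := by
  have h := FiniteField.roots_X_pow_card_sub_X (ZMod p)
  rw [ZMod.card] at h
  rw [← count_roots, h]
  exact Multiset.count_eq_one_of_mem Finset.univ.nodup (by simp)

lemma eval_eval_eq (G : (ZMod p)[X][X]) (L : (ZMod p)[X]) (c : ZMod p) :
    (G.eval L).eval c = (G.eval (C (L.eval c))).eval c := by
  simp only [eval_eq_sum_range (p := G), eval_finsetSum, eval_mul, eval_pow, eval_C]

lemma eval_eval_X_pow (G : (ZMod p)[X][X]) (c : ZMod p) :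
    (G.eval (X ^ p)).eval c = (G.eval (C c)).eval c := by
  rw [eval_eval_eq, eval_pow, eval_X, ZMod.pow_card]

lemma eval_eval_X (G : (ZMod p)[X][X]) (c : ZMod p) :
    (G.eval X).eval c = (G.eval (C c)).eval c := by
  rw [eval_eval_eq, eval_X]

lemma WeightLE.of_linear_mul {d n : ℕ} (hd : 1 ≤ d) {L : (ZMod p)[X]} (hL : L.natDegree ≤ d)
    {C' : (ZMod p)[X][X]} (hC : WeightLE d ((n + 1) * d) ((X - C L) * C'))
    (htop : ((X - C L) * C').coeff (n + 1) = 1) :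
    WeightLE d (n * d) C' ∧ C'.coeff n = 1 := by
  have hrec : ∀ i, C'.coeff i = ((X - C L) * C').coeff (i + 1) + L * C'.coeff (i + 1) := by
    intro i
    rw [sub_mul, coeff_sub, coeff_X_mul, coeff_C_mul]; ring
  have key : ∀ t i, C'.natDegree < i + t → ∀ j, n * d < i * d + j → (C'.coeff i).coeff j = 0 := by
    intro t
    induction t with
    | zero =>
      intro i hi j _
      rw [coeff_eq_zero_of_natDegree_lt (by omega : C'.natDegree < i), coeff_zero]
    | succ t ih =>
      intro i hi j hij
      rw [hrec, coeff_add, hC _ _ (by rw [add_mul, add_mul]; omega), zero_add, coeff_mul]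
      refine Finset.sum_eq_zero fun x hx => ?_
      rw [HasAntidiagonal.mem_antidiagonal] at hx
      by_cases h1 : d < x.1
      · rw [coeff_eq_zero_of_natDegree_lt (by omega), zero_mul]
      · rw [ih (i + 1) (by omega) x.2 (by rw [add_mul]; omega), mul_zero]
  have hw : WeightLE d (n * d) C' := fun i j h => key (C'.natDegree + 1) i (by omega) j h
  refine ⟨hw, ?_⟩
  rw [hrec, htop, hw.coeff_eq_zero (by rw [add_mul]; omega), mul_zero, add_zero]

lemma card_roots_le_add_derivative {G : (ZMod p)[X]} (hG : derivative G ≠ 0) :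
    G.roots.card ≤ #G.roots.toFinset + (derivative G).natDegree := by
  have h : G.roots ≤ G.roots.dedup + (derivative G).roots := by
    rw [Multiset.le_iff_count]
    intro c
    rw [Multiset.count_add, count_roots, count_roots]
    have h1 := rootMultiplicity_sub_one_le_derivative_rootMultiplicity_of_ne_zero G c hG
    by_cases hc : c ∈ G.roots
    · rw [Multiset.count_eq_one_of_mem (Multiset.nodup_dedup _) (Multiset.mem_dedup.2 hc)]
      omega
    · have : rootMultiplicity c G = 0 := by rw [← count_roots]; exact Multiset.count_eq_zero.2 hc
      omega
  have h2 := Multiset.card_le_card h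
  rw [Multiset.card_add] at h2
  exact h2.trans (Nat.add_le_add le_rfl (card_roots' _))

/-- If `C(X ^ p, X)` has almost as many roots in `𝔽_p` as its degree, then `C` is divisible by
`Y - X` or by some `Y - c`. -/
lemma exists_linear_factor {d n r : ℕ} (hd : 1 ≤ d) {G : (ZMod p)[X][X]}
    (hw : WeightLE d ((n + 1) * d) G) (htop : G.coeff (n + 1) = 1)
    (hp : (n + 2) * d + r ≤ p)
    (hroots : (n + 1) * p ≤ (G.eval (X ^ p)).roots.card + r) :
    G.eval X = 0 ∨ ∃ c, G.eval (C c) = 0 := by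
  by_contra! hcon
  obtain ⟨hX, hc⟩ := hcon
  have hp0 : 0 < p := (Fact.out : p.Prime).pos
  have hnd : (n + 1) * d + d + r ≤ p := by
    have : (n + 2) * d = (n + 1) * d + d := by ring
    omega
  have hdeg : ∀ i, (G.coeff i).natDegree < p := fun i =>
    (hw.natDegree_coeff_le i).trans_lt (by omega)
  have hcoef := fun i j hj => coeff_eval_X_pow (j := j) hdeg i hj
  have hdist : #(G.eval (X ^ p)).roots.toFinset ≤ (n + 1) * d := by
    have hsub : (G.eval (X ^ p)).roots.toFinset ⊆ (G.eval X).roots.toFinset := by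
      intro c hcm
      rw [Multiset.mem_toFinset] at hcm ⊢
      have := isRoot_of_mem_roots hcm
      rw [mem_roots hX, IsRoot.def, eval_eval_X, ← eval_eval_X_pow]
      exact this
    refine (Finset.card_le_card hsub).trans ((Multiset.toFinset_card_le _).trans
      ((card_roots' _).trans ?_))
    rw [eval_eq_sum_range]
    refine natDegree_sum_le_of_forall_le _ _ fun i _ => ?_
    by_cases hi : (n + 1) * d < i * d
    · rw [hw.coeff_eq_zero hi]; simp
    · refine (natDegree_mul_le_of_le le_rfl (natDegree_X_pow_le i)).trans ?_
      have h1 := hw.natDegree_coeff_le i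
      have h2 : i ≤ i * d := Nat.le_mul_of_pos_right _ hd
      omega
  by_cases hder : derivative (G.eval (X ^ p)) = 0
  · have hconst : ∀ i, G.coeff i = C ((G.coeff i).coeff 0) := by
      intro i
      ext j
      rw [coeff_C]
      split_ifs with hj
      · rw [hj]
      · by_cases hjp : j < p
        · have h1 := congrArg (fun q => coeff q (p * i + j - 1)) hder
          simp only [coeff_derivative, coeff_zero] at h1
          rw [show p * i + j - 1 + 1 = p * i + j by omega, hcoef i j hjp] at h1
          rcases mul_eq_zero.1 h1 with h1 | h1
          · exact h1
          · exfalso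
            have h2 : ((j : ℕ) : ZMod p) = 0 := by
              have : ((p * i + j - 1 : ℕ) : ZMod p) + 1 = ((p * i + j : ℕ) : ZMod p) := by
                rw [← Nat.cast_succ]; congr 1; omega
              rw [this] at h1
              simpa using h1
            rw [ZMod.natCast_eq_zero_iff] at h2
            exact absurd (Nat.le_of_dvd (by omega) h2) (by omega)
        · exact coeff_eq_zero_of_natDegree_lt ((hdeg i).trans_le (by omega))
    have hne : (G.eval (X ^ p)).roots ≠ 0 := by
      intro h0
      rw [h0, Multiset.card_zero, add_mul] at hroots
      omega
    obtain ⟨c, hcm⟩ := Multiset.exists_mem_of_ne_zero hne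
    have hroot := isRoot_of_mem_roots hcm
    rw [IsRoot.def, eval_eval_X_pow] at hroot
    apply hc c
    have : G.eval (C c) = C ((G.eval (C c)).eval c) := by
      rw [eval_eq_sum_range, eval_finsetSum, map_sum]
      refine Finset.sum_congr rfl fun i _ => ?_
      rw [hconst i]
      simp
    rw [this, hroot, C_0]
  · have h1 := card_roots_le_add_derivative hder
    have h2 : (derivative (G.eval (X ^ p))).natDegree ≤ n * p + d - 1 := by
      rw [eval_eq_sum_range, derivative_sum]
      refine natDegree_sum_le_of_forall_le _ _ fun i _ => ?_
      rw [← pow_mul, derivative_mul, derivative_X_pow]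
      simp only [Nat.cast_mul, CharP.cast_eq_zero, zero_mul, map_zero, mul_zero, add_zero]
      rcases lt_trichotomy i (n + 1) with hi | hi | hi
      · by_cases hz : derivative (G.coeff i) = 0
        · rw [hz]; simp
        · refine (natDegree_mul_le_of_le le_rfl (natDegree_X_pow_le _)).trans ?_
          have h3 := natDegree_derivative_le (G.coeff i)
          have h4 := hw.natDegree_coeff_le i
          obtain ⟨k, rfl⟩ : ∃ k, n = i + k := ⟨n - i, by omega⟩
          have h5 : (i + k + 1) * d - i * d = k * d + d := by
            rw [add_assoc i k 1, add_mul, Nat.add_sub_cancel_left]; ring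
          have h6 : k * d ≤ k * p := Nat.mul_le_mul_left _ (by omega)
          have h7 : (i + k) * p = p * i + k * p := by ring
          omega
      · rw [hi, htop]; simp
      · rw [hw.coeff_eq_zero (Nat.mul_lt_mul_of_pos_right hi (by omega))]; simp
    have : (n + 1) * p = n * p + p := by ring
    omega

theorem rootMultiplicity_eval_X_pow {d r : ℕ} (hd : 1 ≤ d) (n : ℕ) :
    ∀ G : (ZMod p)[X][X], WeightLE d (n * d) G → G.coeff n = 1 → (n + 1) * d + r ≤ p →
      n * p ≤ (G.eval (X ^ p)).roots.card + r →
      ∃ s : Multiset (ZMod p), s.card ≤ n ∧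
        ∀ c, rootMultiplicity c (G.eval (X ^ p)) = (n - s.card) + p * s.count c := by
  induction n with
  | zero =>
    intro G hw htop _ _
    have hG : G = 1 := by
      ext1 i
      rcases Nat.eq_zero_or_pos i with rfl | hi
      · rw [htop]; simp
      · rw [hw.coeff_eq_zero (by simpa using ⟨hi, hd⟩), coeff_one, if_neg (by omega)]
    exact ⟨0, by simp, fun c => by
      rw [hG, eval_one, ← C_1, rootMultiplicity_C]; simp⟩
  | succ n ih =>
    intro G hw htop hp hroots
    have hp0 : 0 < p := (Fact.out : p.Prime).pos
    have hstep : ∀ L : (ZMod p)[X], L.natDegree ≤ d → G.eval L = 0 →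
        ∃ G' : (ZMod p)[X][X], WeightLE d (n * d) G' ∧ G'.coeff n = 1 ∧
          G.eval (X ^ p) = (X ^ p - L) * G'.eval (X ^ p) := by
      intro L hL h0
      obtain ⟨G', rfl⟩ := dvd_iff_isRoot.2 h0
      obtain ⟨h1, h2⟩ := WeightLE.of_linear_mul hd hL hw htop
      exact ⟨G', h1, h2, by simp⟩
    have hne : G.eval (X ^ p) ≠ 0 := by
      intro h0
      rw [h0, roots_zero, Multiset.card_zero, add_mul] at hroots
      have : 0 < (n + 1 + 1) * d := by positivity
      omega
    have hp' : (n + 1) * d + r ≤ p := by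
      have : (n + 1 + 1) * d = (n + 1) * d + d := by ring
      omega
    rcases exists_linear_factor hd hw htop hp hroots with h0 | ⟨a, h0⟩
    · obtain ⟨G', hw', htop', hG⟩ := hstep X (by simpa using hd) h0
      rw [hG] at hne hroots ⊢
      have hX := FiniteField.roots_X_pow_card_sub_X (ZMod p)
      rw [ZMod.card] at hX
      rw [roots_mul hne, Multiset.card_add, hX] at hroots
      obtain ⟨s, hs, hmul⟩ := ih G' hw' htop' hp' (by
        have : Multiset.card (univ : Finset (ZMod p)).val = p := by
          rw [← Finset.card_def, Finset.card_univ, ZMod.card]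
        rw [this, add_mul] at hroots
        omega)
      refine ⟨s, by omega, fun c => ?_⟩
      rw [rootMultiplicity_mul hne, hmul, rootMultiplicity_X_pow_sub_X]
      omega
    · obtain ⟨G', hw', htop', hG⟩ := hstep (C a) (by simp) h0
      rw [hG, X_pow_sub_C_eq] at hne hroots ⊢
      rw [roots_mul hne, Multiset.card_add, roots_pow, roots_X_sub_C] at hroots
      obtain ⟨s, hs, hmul⟩ := ih G' hw' htop' hp' (by
        simp only [Multiset.card_nsmul, Multiset.card_singleton] at hroots
        rw [add_mul] at hroots
        simp at hroots
        omega)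
      refine ⟨a ::ₘ s, by simpa using hs, fun c => ?_⟩
      rw [rootMultiplicity_mul hne, hmul, ← count_roots, roots_pow, roots_X_sub_C,
        Multiset.count_nsmul, Multiset.count_singleton, Multiset.count_cons, Multiset.card_cons,
        show n + 1 - (s.card + 1) = n - s.card by omega]
      ring

end Curve

section PointIdeals

lemma Ideal.exists_of_mem_span_pair_pow_succ {A : Type*} [CommRing A] {z t : A} (n : ℕ) :
    ∀ {x : A}, x ∈ Ideal.span {z, t} ^ (n + 1) →
      ∃ g, ∃ q ∈ Ideal.span {z, t} ^ n, x = t ^ (n + 1) * g + z * q := by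
  induction n with
  | zero =>
    intro x hx
    rw [zero_add, pow_one, Ideal.mem_span_pair] at hx
    obtain ⟨a, b, rfl⟩ := hx
    exact ⟨b, a, by simp, by ring⟩
  | succ n ih =>
    intro x hx
    rw [pow_succ'] at hx
    refine Submodule.mul_induction_on hx ?_ ?_
    · intro a ha b hb
      obtain ⟨g, q, hq, hbq⟩ := ih hb
      rw [Ideal.mem_span_pair] at ha
      obtain ⟨u, v, rfl⟩ := ha
      refine ⟨v * g, u * b + v * (t * q), Ideal.add_mem _ (Ideal.mul_mem_left _ _ hb)
        (Ideal.mul_mem_left _ _ ?_), by rw [hbq]; ring⟩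
      rw [pow_succ']
      exact Ideal.mul_mem_mul (Ideal.subset_span (by simp)) hq
    · rintro _ _ ⟨g, q, hq, rfl⟩ ⟨g', q', hq', rfl⟩
      exact ⟨g + g', q + q', Ideal.add_mem _ hq hq', by ring⟩

lemma Ideal.divMod_byMonic_of_mem_span_pair_pow {A : Type*} [CommRing A] [Nontrivial A] {Z : A[X]}
    (hZ : Z.Monic) {t : A} {n : ℕ} {P : A[X]} (hP : P ∈ Ideal.span {Z, C t} ^ (n + 1)) :
    P /ₘ Z ∈ Ideal.span {Z, C t} ^ n ∧ ∀ i, t ^ (n + 1) ∣ (P %ₘ Z).coeff i := by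
  obtain ⟨g, q, hq, rfl⟩ := Ideal.exists_of_mem_span_pair_pow_succ n hP
  obtain ⟨h1, h2⟩ := div_modByMonic_unique (f := C t ^ (n + 1) * g + Z * q)
    (C (t ^ (n + 1)) * (g /ₘ Z) + q) (C (t ^ (n + 1)) * (g %ₘ Z)) hZ
    ⟨by
      conv_rhs => rw [← modByMonic_add_div g Z]
      rw [C_pow]; ring,
    lt_of_le_of_lt (by
      rw [← smul_eq_C_mul]; exact degree_smul_le _ _) (degree_modByMonic_lt g hZ)⟩
  rw [h1, h2]
  refine ⟨Ideal.add_mem _ (Ideal.mul_mem_right _ _ ?_) hq, fun i => ?_⟩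
  · rw [C_pow]
    exact Ideal.pow_le_pow_right (Nat.le_succ n)
      (Ideal.pow_mem_pow (Ideal.subset_span (by simp)) _)
  · rw [coeff_C_mul]
    exact dvd_mul_right _ _

variable {p : ℕ} [Fact p.Prime]

lemma prod_X_sub_C_eq_X_pow_sub_X : ∏ c : ZMod p, (X - C c) = (X ^ p - X : (ZMod p)[X]) := by
  have hX := FiniteField.roots_X_pow_card_sub_X (ZMod p)
  rw [ZMod.card] at hX
  have hp := (Fact.out : p.Prime).one_lt
  have hmonic : (X ^ p - X : (ZMod p)[X]).Monic := monic_X_pow_sub (by simpa using hp)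
  have := prod_multiset_X_sub_C_of_monic_of_roots_card_eq hmonic (by
    rw [hX, FiniteField.X_pow_card_sub_X_natDegree_eq _ hp, ← Finset.card_def, Finset.card_univ,
      ZMod.card])
  rw [hX] at this
  exact this

/-- The ideal of polynomials vanishing at the point `(X, Y) = (c, m)`; the variable `Y` is the
inner one. -/
noncomputable def pointIdeal (c m : ZMod p) : Ideal (ZMod p)[X][X] :=
  Ideal.span {X - C (C c), C (X - C m)}

/-- The ideal of polynomials vanishing at all points of the line `Y = m`. -/
noncomputable def lineIdeal (m : ZMod p) : Ideal (ZMod p)[X][X] :=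
  Ideal.span {X ^ p - X, C (X - C m)}

lemma prod_pointIdeal_le (m : ZMod p) : ∏ c : ZMod p, pointIdeal c m ≤ lineIdeal m := by
  have h : ∀ s : Finset (ZMod p), ∏ c ∈ s, pointIdeal c m ≤
      Ideal.span {∏ c ∈ s, (X - C (C c)), C (X - C m)} := by
    intro s
    induction s using Finset.induction_on with
    | empty =>
      rw [prod_empty, prod_empty]
      exact fun x _ => by
        rw [Ideal.eq_top_of_isUnit_mem _ (Ideal.subset_span (by simp)) isUnit_one]; trivial
    | insert a s ha ih =>
      rw [prod_insert ha, prod_insert ha]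
      refine (Ideal.mul_mono_right ih).trans ?_
      rw [pointIdeal, Ideal.mul_le]
      intro x hx y hy
      rw [Ideal.mem_span_pair] at hx hy ⊢
      obtain ⟨u, v, rfl⟩ := hx
      obtain ⟨u', v', rfl⟩ := hy
      exact ⟨u * u', u * (X - C (C a)) * v' + v * (u' * (∏ c ∈ s, (X - C (C c))) +
        v' * C (X - C m)), by ring⟩
  refine (h univ).trans_eq ?_
  rw [lineIdeal]
  have := congrArg (Polynomial.map (C : ZMod p →+* (ZMod p)[X]))
    (prod_X_sub_C_eq_X_pow_sub_X (p := p))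
  simp only [Polynomial.map_prod, Polynomial.map_sub, map_X, map_C, Polynomial.map_pow] at this
  rw [this]

lemma mem_lineIdeal_pow {m : ZMod p} {n : ℕ} {F : (ZMod p)[X][X]}
    (h : ∀ c, F ∈ pointIdeal c m ^ n) : F ∈ lineIdeal m ^ n := by
  have hcop : Pairwise fun c c' : ZMod p =>
      IsCoprime (pointIdeal c m ^ n) (pointIdeal c' m ^ n) := by
    intro c c' hcc
    refine IsCoprime.pow ?_
    rw [Ideal.isCoprime_iff_exists]
    have h1 : (c' - c) * (c' - c)⁻¹ = 1 := mul_inv_cancel₀ (sub_ne_zero.2 hcc.symm)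
    refine ⟨C (C (c' - c)⁻¹) * (X - C (C c)),
      Ideal.mul_mem_left _ _ (Ideal.subset_span (by simp)),
      -C (C (c' - c)⁻¹) * (X - C (C c')),
      Ideal.mul_mem_left _ _ (Ideal.subset_span (by simp)), ?_⟩
    calc _ = C (C ((c' - c) * (c' - c)⁻¹)) := by simp only [C_mul, C_sub]; ring
      _ = 1 := by rw [h1]; simp
  have h2 : F ∈ ∏ c : ZMod p, pointIdeal c m ^ n := by
    rw [Ideal.prod_eq_iInf_of_pairwise_isCoprime (fun c _ c' _ hcc => hcop hcc)]
    simpa using h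
  rw [Finset.prod_pow] at h2
  exact Ideal.pow_right_mono (prod_pointIdeal_le m) n h2

lemma mem_pointIdeal {c m : ZMod p} {f : (ZMod p)[X][X]}
    (h : (f.map (evalRingHom m)).eval c = 0) : f ∈ pointIdeal c m := by
  have h1 : (f.eval (C c)).eval m = 0 := by
    rw [← h, eval_map, eval₂_evalRingHom, evalEval]
  obtain ⟨u, hu⟩ := dvd_iff_isRoot.2 h1
  obtain ⟨v, hv⟩ := X_sub_C_dvd_sub_C_eval (p := f) (a := C c)
  rw [pointIdeal, Ideal.mem_span_pair]
  refine ⟨v, C u, ?_⟩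
  rw [sub_eq_iff_eq_add] at hv
  rw [hv, hu, C_mul]
  ring

lemma eq_zero_of_pow_dvd {M : Finset (ZMod p)} {n : ℕ} {b : (ZMod p)[X]}
    (h : ∀ m ∈ M, (X - C m) ^ n ∣ b) (hb : b.natDegree < n * #M) : b = 0 := by
  by_contra hne
  have hdvd : ∏ m ∈ M, (X - C m) ^ n ∣ b :=
    Finset.prod_dvd_of_coprime (fun m _ m' _ hmm =>
      (pairwise_coprime_X_sub_C Function.injective_id hmm).pow) h
  have := natDegree_le_of_dvd hdvd hne
  rw [Finset.prod_pow, natDegree_pow, natDegree_finsetProd_X_sub_C_eq_card] at this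
  omega

theorem exists_weightLE_eval_X_pow {d : ℕ} (hd : 1 ≤ d) {M : Finset (ZMod p)} (hM : p ≤ #M + d)
    (y : ZMod p) (n : ℕ) : ∀ F : (ZMod p)[X][X], WeightLE 1 (n * p) F → F.coeff (n * p) = 1 →
      (∀ m ∈ M, F ∈ lineIdeal m ^ n) →
      ∃ G : (ZMod p)[X][X], WeightLE d (n * d) G ∧ G.coeff n = 1 ∧
        G.eval (X ^ p) = F.map (evalRingHom y) := by
  have hp := (Fact.out : p.Prime).one_lt
  induction n with
  | zero =>
    intro F hF htop _
    refine ⟨1, by simpa using WeightLE.of_X_pow (A := ZMod p) (d := d) 0, by simp, ?_⟩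
    have : F = 1 := by
      ext1 i
      rcases Nat.eq_zero_or_pos i with rfl | hi
      · simpa using htop
      · rw [hF.coeff_eq_zero (by simpa using hi), coeff_one, if_neg (by omega)]
    simp [this]
  | succ n ih =>
    intro F hF htop hI
    have hmonic : (X ^ p - X : (ZMod p)[X][X]).Monic := monic_X_pow_sub (by simpa using hp)
    have hdegZ : (X ^ p - X : (ZMod p)[X][X]).natDegree = p := by
      rw [natDegree_sub_eq_left_of_natDegree_lt] <;> simp [hp]
    have hZw : WeightLE (A := ZMod p) 1 p (X ^ p - X) := by
      refine WeightLE.sub ?_ (WeightLE.of_X.mono hp.le)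
      simpa using WeightLE.of_X_pow (A := ZMod p) (d := 1) p
    have hnp : (n + 1) * p = n * p + p := by ring
    obtain ⟨hQw, hRw⟩ := WeightLE.divMod_byMonic hmonic hdegZ hZw (by omega) hF
    have hdm := modByMonic_add_div F (X ^ p - X)
    set Q := F /ₘ (X ^ p - X)
    set R := F %ₘ (X ^ p - X)
    rw [hnp, Nat.add_sub_cancel] at hQw
    have hRdeg : ∀ i, p ≤ i → R.coeff i = 0 := by
      have := degree_modByMonic_lt F hmonic
      rw [degree_eq_natDegree hmonic.ne_zero, hdegZ] at this
      exact (degree_lt_iff_coeff_zero _ _).1 this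
    have hQtop : Q.coeff (n * p) = 1 := by
      rw [← htop, ← hdm, coeff_add, hRdeg _ (by omega), sub_mul, coeff_sub, hnp, coeff_X_pow_mul,
        show n * p + p = n * p + p - 1 + 1 by omega, coeff_X_mul,
        hQw.coeff_eq_zero (i := n * p + p - 1) (by omega)]
      ring
    have hdig := fun m hm => Ideal.divMod_byMonic_of_mem_span_pair_pow hmonic (hI m hm)
    obtain ⟨G, hGw, hGtop, hG⟩ := ih Q hQw hQtop fun m hm => (hdig m hm).1
    have hRsmall : ∀ i, (n + 1) * d < i → R.coeff i = 0 := by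
      intro i hi
      by_cases hi' : (n + 1) * p < i * 1
      · exact hRw.coeff_eq_zero hi'
      · refine eq_zero_of_pow_dvd (fun m hm => (hdig m hm).2 i) ?_
        have h1 := hRw.natDegree_coeff_le i
        have h2 := Nat.mul_le_mul_left (n + 1) hM
        rw [mul_add] at h2
        omega
    refine ⟨(X - C X) * G + C (R.map (evalRingHom y)), ?_, ?_, ?_⟩
    · refine WeightLE.add (((WeightLE.of_X.sub (WeightLE.of_C fun j hj => ?_)).mul hGw).mono
        (by rw [add_mul]; omega)) (WeightLE.of_C fun j hj => ?_)
      · rw [coeff_X_of_ne_one (by omega)]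
      · rw [coeff_map, hRsmall j hj, map_zero]
    · rw [sub_mul, coeff_add, coeff_sub, coeff_X_mul, coeff_C_mul, coeff_C_succ, hGtop,
        hGw.coeff_eq_zero (by rw [add_mul]; omega)]
      ring
    · rw [← hdm]
      simp [hG, add_comm]

end PointIdeals

section RedeiPolynomial

variable {p : ℕ} [Fact p.Prime] {ι : Type*}

/-- The Rédei polynomial `∏ (X - β u + α u Y)` of a family of points `(α u, β u)`. -/
noncomputable def redeiPoly (U : Finset ι) (α β : ι → ZMod p) : (ZMod p)[X][X] :=
  ∏ u ∈ U, (X - C (C (β u) - C (α u) * X))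

variable (U : Finset ι) (α β : ι → ZMod p)

lemma redeiPoly_monic : (redeiPoly U α β).Monic := monic_prod_X_sub_C _ _

lemma natDegree_redeiPoly : (redeiPoly U α β).natDegree = #U := by
  rw [redeiPoly, natDegree_prod_of_monic _ _ fun u _ => monic_X_sub_C _,
    sum_congr rfl fun u _ => natDegree_X_sub_C _, sum_const, smul_eq_mul, mul_one]

lemma weightLE_redeiPoly : WeightLE 1 #U (redeiPoly U α β) := by
  have := WeightLE.prod (d := 1) U (fun u => (X - C (C (β u) - C (α u) * X) : (ZMod p)[X][X])) 1
    fun u _ => WeightLE.of_X.sub (WeightLE.of_C fun j hj => by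
      rw [coeff_sub, coeff_C_mul, coeff_X_of_ne_one (by omega), coeff_C, if_neg (by omega)]; simp)
  rwa [mul_one] at this

lemma map_redeiPoly (y : ZMod p) : (redeiPoly U α β).map (evalRingHom y) =
    ∏ u ∈ U, (X - C (β u - y * α u)) := by
  rw [redeiPoly, Polynomial.map_prod]
  refine prod_congr rfl fun u _ => ?_
  rw [mul_comm y]
  simp

lemma roots_prod_X_sub_C_comp (g : ι → ZMod p) :
    (∏ u ∈ U, (X - C (g u))).roots = U.val.map g := by
  rw [← roots_multiset_prod_X_sub_C (U.val.map g), Multiset.map_map]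
  rfl

lemma rootMultiplicity_map_redeiPoly (y c : ZMod p) :
    rootMultiplicity c ((redeiPoly U α β).map (evalRingHom y)) =
      #{u ∈ U | β u - y * α u = c} := by
  rw [← count_roots, map_redeiPoly, roots_prod_X_sub_C_comp, Multiset.count_map]
  rw [filter_congr fun u _ => eq_comm]
  rfl

lemma map_redeiPoly_dvd {y : ZMod p} {n : ℕ} (h : ∀ c, #{u ∈ U | β u - y * α u = c} ≤ n) :
    (redeiPoly U α β).map (evalRingHom y) ∣ (X ^ p - X) ^ n := by
  rw [map_redeiPoly, ← prod_X_sub_C_eq_X_pow_sub_X, ← Finset.prod_pow,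
    ← prod_fiberwise (s := U) (g := fun u => β u - y * α u)]
  refine prod_dvd_prod_of_dvd _ _ fun c _ => ?_
  rw [prod_congr rfl (g := fun _ => (X - C c)) fun u hu => by rw [(mem_filter.1 hu).2], prod_const]
  exact pow_dvd_pow _ (h c)

lemma redeiPoly_mem_pointIdeal_pow (m c : ZMod p) :
    redeiPoly U α β ∈ pointIdeal c m ^ #{u ∈ U | β u - m * α u = c} := by
  rw [redeiPoly, ← prod_filter_mul_prod_filter_not U (fun u => β u - m * α u = c)]
  refine Ideal.mul_mem_right _ _ ?_
  rw [← prod_const (pointIdeal c m)]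
  refine Ideal.prod_mem_prod fun u hu => mem_pointIdeal ?_
  rw [← (mem_filter.1 hu).2, mul_comm m]
  simp

/-- The cofactor of the Rédei polynomial specialises, in a direction with small fibres, to the
cofactor of the specialisation in `(X ^ p - X) ^ n`. -/
lemma map_redeiPoly_mul_map_divByMonic {y : ZMod p} {n r : ℕ} (hn : 1 ≤ n) (hr : r + n < p)
    (hU : #U + r = n * p) (h : ∀ c, #{u ∈ U | β u - y * α u = c} ≤ n) :
    (redeiPoly U α β).map (evalRingHom y) *
      ((X ^ (n * p) /ₘ redeiPoly U α β).map (evalRingHom y)) = (X ^ p - X) ^ n := by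
  obtain ⟨g, hg⟩ := map_redeiPoly_dvd U α β h
  have hmon := (redeiPoly_monic U α β).map (evalRingHom y)
  have hp := (Fact.out : p.Prime).one_lt
  rw [map_divByMonic _ (redeiPoly_monic U α β), Polynomial.map_pow, map_X]
  rw [(div_modByMonic_unique g (X ^ (n * p) - (X ^ p - X) ^ n) hmon ⟨by rw [hg]; ring, ?_⟩).1, hg]
  obtain ⟨n, rfl⟩ := Nat.exists_eq_add_of_le' hn
  rw [degree_eq_natDegree hmon.ne_zero, (redeiPoly_monic U α β).natDegree_map,
    natDegree_redeiPoly]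
  refine (degree_le_natDegree).trans_lt (Nat.cast_lt.2 ?_)
  have hnp : (n + 1) * p = p * n + p := by ring
  have hdeg : (X ^ p - X : (ZMod p)[X]).natDegree ≤ p := by
    rw [FiniteField.X_pow_card_sub_X_natDegree_eq _ hp]
  rw [mul_comm, pow_mul, ← geom_sum₂_mul, sub_sub_cancel]
  refine natDegree_mul_le.trans_lt ?_
  have : (∑ i ∈ range (n + 1), (X ^ p : (ZMod p)[X]) ^ i * (X ^ p - X) ^ (n + 1 - 1 - i)).natDegree
      ≤ p * n := by
    refine natDegree_sum_le_of_forall_le _ _ fun i hi => natDegree_mul_le.trans ?_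
    have hi' : n = i + (n + 1 - 1 - i) := by rw [mem_range] at hi; omega
    have h1 := natDegree_pow_le_of_le (n + 1 - 1 - i) hdeg
    rw [← pow_mul, natDegree_X_pow]
    calc _ ≤ p * i + (n + 1 - 1 - i) * p := by gcongr
      _ = p * (i + (n + 1 - 1 - i)) := by ring
      _ = p * n := by rw [← hi']
  rw [natDegree_X]
  omega

/-- Lacunary structure of the fibres of `U` in an arbitrary direction `y`, provided sufficiently
many directions have all fibres of size `n - 1` or `n`. -/
theorem exists_card_fiber_add_eq {n r d : ℕ} (hn : 1 ≤ n) (hr : r + n < p) (hU : #U + r = n * p)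
    (hd : 1 ≤ d) (hdp : (n + 1) * d + r ≤ p) {M : Finset (ZMod p)} (hM : p ≤ #M + d)
    (hfib : ∀ m ∈ M, ∀ c, #{u ∈ U | β u - m * α u = c} ≤ n ∧
      n ≤ #{u ∈ U | β u - m * α u = c} + 1) (y : ZMod p) :
    ∃ s : Multiset (ZMod p), s.card ≤ n ∧ ∀ c, ∃ e ≤ r,
      #{u ∈ U | β u - y * α u = c} + e = (n - s.card) + p * s.count c := by
  set H := redeiPoly U α β
  have hH : H.Monic := redeiPoly_monic U α β
  have hHd : H.natDegree = #U := natDegree_redeiPoly U α β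
  have hXw : WeightLE (A := ZMod p) 1 (n * p) (X ^ (n * p)) := by
    simpa using WeightLE.of_X_pow (A := ZMod p) (d := 1) (n * p)
  set f := X ^ (n * p) /ₘ H
  have hfw : WeightLE 1 r f := by
    have := (WeightLE.divMod_byMonic hH hHd (weightLE_redeiPoly U α β) (by omega) hXw).1
    rwa [show n * p - #U = r by omega] at this
  have hdeg : H.degree ≤ (X ^ (n * p) : (ZMod p)[X][X]).degree := by
    rw [degree_eq_natDegree hH.ne_zero, degree_X_pow, hHd]
    exact Nat.cast_le.2 (by omega)
  have hf : f.Monic := by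
    rw [Monic, leadingCoeff_divByMonic_of_monic hH hdeg, (monic_X_pow _).leadingCoeff]
  have hfd : f.natDegree = r := by
    rw [natDegree_divByMonic _ hH, natDegree_X_pow, hHd, ← hU, Nat.add_sub_cancel_left]
  have hFtop : (H * f).coeff (n * p) = 1 := by
    have := (hH.mul hf).coeff_natDegree
    rwa [hH.natDegree_mul hf, hHd, hfd, hU] at this
  have hFw : WeightLE 1 (n * p) (H * f) :=
    ((weightLE_redeiPoly U α β).mul hfw).mono hU.le
  obtain ⟨G, hGw, hGtop, hG⟩ := exists_weightLE_eval_X_pow hd hM y n (H * f) hFw hFtop (by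
    intro m hm
    refine mem_lineIdeal_pow fun c => ?_
    have hmem := redeiPoly_mem_pointIdeal_pow U α β m c
    obtain ⟨h1, h2⟩ := hfib m hm c
    rcases h1.eq_or_lt with h | h
    · rw [h] at hmem
      exact Ideal.mul_mem_right _ _ hmem
    · have hk : #{u ∈ U | β u - m * α u = c} + 1 = n := by omega
      rw [← hk, pow_succ (M := Ideal (ZMod p)[X][X])]
      refine Ideal.mul_mem_mul hmem (mem_pointIdeal ?_)
      have hmap := map_redeiPoly_mul_map_divByMonic U α β hn hr hU fun c => (hfib m hm c).1
      by_contra hne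
      have hm1 := congrArg (rootMultiplicity c) hmap
      have hz : (X ^ p - X : (ZMod p)[X]) ^ n ≠ 0 :=
        pow_ne_zero _ (FiniteField.X_pow_card_sub_X_ne_zero _ (Fact.out : p.Prime).one_lt)
      rw [rootMultiplicity_mul (by rw [hmap]; exact hz), rootMultiplicity_map_redeiPoly,
        rootMultiplicity_eq_zero hne, ← count_roots, roots_pow, Multiset.count_nsmul, count_roots,
        rootMultiplicity_X_pow_sub_X] at hm1
      omega)
  have hne : H.map (evalRingHom y) * f.map (evalRingHom y) ≠ 0 :=
    ((hH.map _).mul (hf.map _)).ne_zero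
  obtain ⟨s, hs, hsc⟩ := rootMultiplicity_eval_X_pow (r := r) hd n G hGw hGtop hdp (by
    rw [hG, Polynomial.map_mul, roots_mul hne, Multiset.card_add, map_redeiPoly,
      roots_prod_X_sub_C_comp, Multiset.card_map, ← hU, ← Finset.card_def]
    omega)
  refine ⟨s, hs, fun c => ⟨rootMultiplicity c (f.map (evalRingHom y)), ?_, ?_⟩⟩
  · rw [← hfd, ← hf.natDegree_map (evalRingHom y)]
    rw [← count_roots]
    exact (Multiset.count_le_card _ _).trans (card_roots' _)
  · rw [← hsc c, hG, Polynomial.map_mul, rootMultiplicity_mul hne, rootMultiplicity_map_redeiPoly]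

end RedeiPolynomial

section Fibers

variable {p : ℕ}

/-- The linear form whose level sets are the lines of slope `m`. -/
def dirProj : Option (ZMod p) → ZMod p × ZMod p → ZMod p
  | some m, u => u.2 - m * u.1
  | none, u => u.1

variable [Fact p.Prime]

lemma mem_lineWithSlope {m : Option (ZMod p)} {c : ZMod p} {u : ZMod p × ZMod p} :
    u ∈ lineWithSlope p m c ↔ dirProj m u = c := by
  cases m <;> simp [lineWithSlope, dirProj, sub_eq_iff_eq_add, add_comm]

lemma lineWithSlope_inter (U : Finset (ZMod p × ZMod p)) (m : Option (ZMod p)) (c : ZMod p) :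
    lineWithSlope p m c ∩ U = {u ∈ U | dirProj m u = c} := by
  ext u
  simp [mem_lineWithSlope, and_comm]

lemma eq_of_dirProj_eq {m m' : Option (ZMod p)} (hm : m ≠ m') {u v : ZMod p × ZMod p}
    (h : dirProj m u = dirProj m v) (h' : dirProj m' u = dirProj m' v) : u = v := by
  obtain ⟨u1, u2⟩ := u
  obtain ⟨v1, v2⟩ := v
  rcases m with _ | m <;> rcases m' with _ | m' <;> simp only [dirProj] at h h'
  · exact absurd rfl hm
  · subst h; simpa using h'
  · subst h'; simpa using h
  · have hmm : m - m' ≠ 0 := sub_ne_zero.2 fun h => hm (by rw [h])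
    have : u1 = v1 := by
      refine mul_left_cancel₀ hmm ?_
      linear_combination h' - h
    subst this; simpa using h

lemma card_filter_dirProj_le (U : Finset (ZMod p × ZMod p)) (m : Option (ZMod p)) (c : ZMod p) :
    #{u ∈ U | dirProj m u = c} ≤ p := by
  obtain ⟨m', hm'⟩ : ∃ m', m ≠ m' := (exists_ne m).imp fun _ h => h.symm
  calc _ ≤ #(univ : Finset (ZMod p)) := by
        refine card_le_card_of_injOn (dirProj m') (fun _ _ => mem_univ _) fun u hu v hv h => ?_
        simp only [coe_filter, Set.mem_ofPred_eq] at hu hv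
        exact eq_of_dirProj_eq hm' (hu.2.trans hv.2.symm) h
    _ = p := by rw [Finset.card_univ, ZMod.card]

/-- Affine coordinates of the plane in which `e` is the vertical direction. -/
lemma exists_chart (e : Option (ZMod p)) :
    ∃ (α β : ZMod p × ZMod p → ZMod p) (σ : ZMod p → Option (ZMod p)) (a : ZMod p → ZMod p),
      Function.Injective σ ∧ (∀ y, σ y ≠ e) ∧ (∀ m, m ≠ e → ∃ y, σ y = m) ∧ (∀ y, a y ≠ 0) ∧
      ∀ y u, β u - y * α u = a y * dirProj (σ y) u := by
  rcases e with _ | s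
  · refine ⟨Prod.fst, Prod.snd, some, 1, Option.some_injective _, by simp, ?_, by simp, ?_⟩
    · exact fun m hm => (Option.ne_none_iff_exists.1 hm)
    · simp [dirProj]
  · refine ⟨fun u => u.2 - s * u.1, Prod.fst, fun y => if y = 0 then none else some (s + y⁻¹),
      fun y => if y = 0 then 1 else -y, ?_, ?_, ?_, ?_, ?_⟩
    · intro y y' h
      by_cases hy : y = 0 <;> by_cases hy' : y' = 0 <;> simp_all
    · intro y
      by_cases hy : y = 0 <;> simp [hy]
    · rintro (_ | m) hm
      · exact ⟨0, by simp⟩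
      · have : m - s ≠ 0 := sub_ne_zero.2 fun h => hm (by rw [h])
        exact ⟨(m - s)⁻¹, by simp [this]⟩
    · intro y
      by_cases hy : y = 0 <;> simp [hy]
    · intro y u
      by_cases hy : y = 0
      · simp [hy, dirProj]
      · simp only [hy, if_false, dirProj]
        field_simp
        ring

lemma isRich_iff {n r : ℕ} {U : Finset (ZMod p × ZMod p)} (hrp : r < p) (hU : #U + r = n * p)
    (m : Option (ZMod p)) (c : ZMod p) :
    IsRich p U (lineWithSlope p m c) ↔ n < #{u ∈ U | dirProj m u = c} := by
  have hp : (0 : ℚ) < p := by exact_mod_cast (Fact.out : p.Prime).pos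
  have hU' : (#U : ℚ) + r = n * p := by exact_mod_cast hU
  have hrp' : (r : ℚ) < p := by exact_mod_cast hrp
  rw [IsRich, lineWithSlope_inter, div_add_one hp.ne', div_le_iff₀ hp]
  generalize #{u ∈ U | dirProj m u = c} = k
  have hr0 : (0 : ℚ) ≤ r := r.cast_nonneg
  constructor
  · intro h
    by_contra! hk
    have : (k : ℚ) ≤ n := by exact_mod_cast hk
    nlinarith
  · intro h
    have : (n : ℚ) + 1 ≤ k := by exact_mod_cast h
    nlinarith

lemma le_card_of_not_isPoor {n r : ℕ} {U : Finset (ZMod p × ZMod p)} (hU : #U + r = n * p)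
    (hrp : r < p) {m : Option (ZMod p)} {c : ZMod p} (h : ¬ IsPoor p U (lineWithSlope p m c)) :
    n ≤ #{u ∈ U | dirProj m u = c} + 1 := by
  have hp : (0 : ℚ) < p := by exact_mod_cast (Fact.out : p.Prime).pos
  have hU' : (#U : ℚ) + r = n * p := by exact_mod_cast hU
  have hrp' : (r : ℚ) < p := by exact_mod_cast hrp
  rw [IsPoor, lineWithSlope_inter, div_sub_one hp.ne', le_div_iff₀ hp] at h
  generalize #{u ∈ U | dirProj m u = c} = k at h ⊢
  by_contra! hk
  have : (k : ℚ) + 2 ≤ n := by exact_mod_cast hk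
  nlinarith

/-- If the sizes of the fibres of a map are lacunary, then the large ones number at most `n`,
and this number controls the sizes of all fibres. -/
lemma lacunary_of_count {n r : ℕ} (hr : r + n < p) {k : ZMod p → ℕ} (hk : ∀ c, k c ≤ p)
    {s : Multiset (ZMod p)} (hs : s.card ≤ n)
    (h : ∀ c, ∃ e ≤ r, k c + e = (n - s.card) + p * s.count c) :
    #{c | n < k c} ≤ n ∧ ∀ c, (n < k c → p + n ≤ k c + r + #{c | n < k c}) ∧
      (k c ≤ n → k c + #{c | n < k c} ≤ n) := by
  have hcount : ∀ c, s.count c ≤ 1 := by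
    intro c
    by_contra! h2
    obtain ⟨e, he, hke⟩ := h c
    have := Nat.mul_le_mul_left p h2
    have := hk c
    omega
  have hiff : ∀ c, n < k c ↔ s.count c = 1 := by
    intro c
    obtain ⟨e, he, hke⟩ := h c
    have := hcount c
    interval_cases hc : s.count c <;> simp <;> omega
  have hcard : #{c | n < k c} = s.card := by
    have : ({c | n < k c} : Finset (ZMod p)) = s.toFinset := by
      ext c
      rw [mem_filter, hiff, Multiset.mem_toFinset, ← Multiset.count_pos]
      have := hcount c
      simp
      omega
    rw [this, Multiset.toFinset_card_of_nodup (Multiset.nodup_iff_count_le_one.2 hcount)]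
  rw [hcard]
  refine ⟨hs, fun c => ⟨fun hc => ?_, fun hc => ?_⟩⟩
  · obtain ⟨e, he, hke⟩ := h c
    rw [(hiff c).1 hc] at hke
    omega
  · obtain ⟨e, he, hke⟩ := h c
    have h1 := hcount c
    have h2 := mt (hiff c).2 hc.not_gt
    rw [show s.count c = 0 by omega] at hke
    omega

end Fibers

section Structure

variable {p : ℕ} [Fact p.Prime]

lemma exists_ne_card_erase_le {α : Type*} [DecidableEq α] [Nontrivial α] (S : Finset α) (m : α) :
    ∃ e ≠ m, #(S.erase e) ≤ max (#S - 1) 1 := by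
  rcases (S.erase m).eq_empty_or_nonempty with h | ⟨e, he⟩
  · obtain ⟨e, he⟩ := exists_ne m
    have h1 : #S - 1 ≤ #(S.erase m) := pred_card_le_card_erase
    have h2 := card_erase_le (s := S) (a := e)
    rw [h, card_empty] at h1
    exact ⟨e, he, by omega⟩
  · rw [mem_erase] at he
    exact ⟨e, he.1, by rw [card_erase_of_mem he.2]; exact le_max_left _ _⟩

/-- With few special directions, the lines of any given slope are either very rich or not rich,
and the number of rich ones controls the intersection sizes. -/
theorem card_inter_line_lacunary {n r : ℕ} {U : Finset (ZMod p × ZMod p)} (hn : 1 ≤ n)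
    (hr : r + n < p) (hU : #U + r = n * p)
    (hD : (n + 1) * #{m | IsSpecialDir p U m} + r ≤ p + n + 1) (m : Option (ZMod p)) :
    #{c | n < #{u ∈ U | dirProj m u = c}} ≤ n ∧ ∀ c,
      (n < #{u ∈ U | dirProj m u = c} →
        p + n ≤ #{u ∈ U | dirProj m u = c} + r + #{c | n < #{u ∈ U | dirProj m u = c}}) ∧
      (#{u ∈ U | dirProj m u = c} ≤ n →
        #{u ∈ U | dirProj m u = c} + #{c | n < #{u ∈ U | dirProj m u = c}} ≤ n) := by
  set S : Finset (Option (ZMod p)) := {m | IsSpecialDir p U m}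
  obtain ⟨e, hem, he⟩ := exists_ne_card_erase_le S m
  obtain ⟨α, β, σ, a, hσ, hσe, hσsurj, ha, hσa⟩ := exists_chart e
  obtain ⟨y, rfl⟩ := hσsurj m hem.symm
  have hdir : ∀ y c, #{u ∈ U | β u - y * α u = a y * c} = #{u ∈ U | dirProj (σ y) u = c} := by
    intro y c
    refine congrArg card (filter_congr fun u _ => ?_)
    rw [hσa, mul_right_inj' (ha y)]
  have hdir' : ∀ y c, #{u ∈ U | β u - y * α u = c} =
      #{u ∈ U | dirProj (σ y) u = (a y)⁻¹ * c} := by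
    intro y c
    rw [← hdir, mul_inv_cancel_left₀ (ha y)]
  set d := max (#S - 1) 1
  have hdp : (n + 1) * d + r ≤ p := by
    rcases le_total #S 2 with h | h
    · have : d = 1 := by omega
      rw [this]; omega
    · obtain ⟨t, ht⟩ := Nat.exists_eq_add_of_le' (show 1 ≤ #S by omega)
      have : d = t := by omega
      rw [this]
      rw [ht, mul_add] at hD
      omega
  have hM : p ≤ #{y | ¬ IsSpecialDir p U (σ y)} + d := by
    have h1 := card_filter_add_card_filter_not (s := (univ : Finset (ZMod p)))
      (fun y => IsSpecialDir p U (σ y))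
    rw [Finset.card_univ, ZMod.card] at h1
    have h2 : #{y | IsSpecialDir p U (σ y)} ≤ #(S.erase e) :=
      card_le_card_of_injOn σ (fun y hy => by simpa [S, hσe] using hy) hσ.injOn
    omega
  obtain ⟨s, hs, hsc⟩ := exists_card_fiber_add_eq U α β hn hr hU (le_max_right _ _) hdp hM (by
    intro y hy c
    simp only [mem_filter, mem_univ, true_and, IsSpecialDir, not_exists, not_or] at hy
    obtain ⟨h1, h2⟩ := hy ((a y)⁻¹ * c)
    rw [hdir']
    exact ⟨not_lt.1 (mt (isRich_iff (by omega) hU _ _).2 h1),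
      le_card_of_not_isPoor hU (by omega) h2⟩) y
  refine lacunary_of_count hr (fun c => card_filter_dirProj_le U _ c) (s := s.map ((a y)⁻¹ * ·))
    (by rwa [Multiset.card_map]) fun c => ?_
  obtain ⟨e, he, h⟩ := hsc (a y * c)
  refine ⟨e, he, ?_⟩
  have hcount := Multiset.count_map_eq_count' ((a y)⁻¹ * ·) s
    (mul_right_injective₀ (inv_ne_zero (ha y))) (a y * c)
  rw [inv_mul_cancel_left₀ (ha y)] at hcount
  rw [Multiset.card_map, hcount, ← hdir, h]

/-- If `U` is not covered by `n` lines, there are fewer than `n` rich lines in each direction. -/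
theorem card_rich_lt {n r : ℕ} {U : Finset (ZMod p × ZMod p)} (hn : 1 ≤ n)
    (hr : r + n < p) (hU : #U + r = n * p)
    (hlines : ¬ ∃ L : Fin n → Option (ZMod p) × ZMod p,
      ∀ u ∈ U, ∃ i : Fin n, u ∈ lineWithSlope p (L i).1 (L i).2)
    (hD : (n + 1) * #{m | IsSpecialDir p U m} + r ≤ p + n + 1) (m : Option (ZMod p)) :
    #{c | n < #{u ∈ U | dirProj m u = c}} < n := by
  obtain ⟨h1, h2⟩ := card_inter_line_lacunary hn hr hU hD m
  refine lt_of_le_of_ne h1 fun heq => hlines ?_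
  refine ⟨fun i => (m, (equivFinOfCardEq heq).symm i), fun u hu => ?_⟩
  have hmem : dirProj m u ∈ ({c | n < #{u ∈ U | dirProj m u = c}} : Finset (ZMod p)) := by
    rw [mem_filter]
    refine ⟨mem_univ _, ?_⟩
    by_contra! h
    have h3 := (h2 _).2 h
    rw [heq] at h3
    have : 0 < #{v ∈ U | dirProj m v = dirProj m u} := card_pos.2 ⟨u, by simp [hu]⟩
    omega
  exact ⟨equivFinOfCardEq heq ⟨_, hmem⟩, by simp [mem_lineWithSlope]⟩

end Structure

section Counting

/-- Counting incidences with a family of lines, where lines of distinct slopes meet at most once: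
`R m` is the set of lines of slope `m` in the family. -/
lemma two_mul_sum_incidences_le {P D A : Type*} [DecidableEq D] [DecidableEq A] (U : Finset P)
    (E : Finset D) (R : D → Finset A) (π : D → P → A)
    (hπ : ∀ m m', m ≠ m' → ∀ u v, π m u = π m v → π m' u = π m' v → u = v) :
    2 * ∑ m ∈ E, #{u ∈ U | π m u ∈ R m} + ∑ m ∈ E, #(R m) ^ 2 ≤
      2 * #U + (∑ m ∈ E, #(R m)) ^ 2 := by
  have hpair : ∀ m m', #{u ∈ U | π m u ∈ R m ∧ π m' u ∈ R m'} +
      (if m = m' then #(R m) ^ 2 else 0) ≤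
      (if m = m' then #{u ∈ U | π m u ∈ R m} else 0) + #(R m) * #(R m') := by
    intro m m'
    split_ifs with h
    · subst h
      simp [sq]
    · rw [add_zero, zero_add, ← card_product]
      refine card_le_card_of_injOn (fun u => (π m u, π m' u)) (fun u hu => ?_) fun u _ v _ huv => ?_
      · simpa using (mem_filter.1 hu).2
      · exact hπ m m' h u v (congrArg Prod.fst huv) (congrArg Prod.snd huv)
  have hsum := sum_le_sum fun m (_ : m ∈ E) => sum_le_sum fun m' (_ : m' ∈ E) => hpair m m'
  have hsq : ∑ m ∈ E, ∑ m' ∈ E, #{u ∈ U | π m u ∈ R m ∧ π m' u ∈ R m'} =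
      ∑ u ∈ U, #{m ∈ E | π m u ∈ R m} ^ 2 := by
    simp_rw [card_filter, sq, sum_mul_sum]
    rw [sum_congr rfl fun m _ => sum_comm, sum_comm]
    refine sum_congr rfl fun u _ => sum_congr rfl fun m _ => sum_congr rfl fun m' _ => ?_
    by_cases h : π m u ∈ R m <;> simp [h]
  have hlin : ∑ m ∈ E, #{u ∈ U | π m u ∈ R m} = ∑ u ∈ U, #{m ∈ E | π m u ∈ R m} := by
    simp_rw [card_filter]
    exact sum_comm
  simp only [sum_add_distrib, sum_ite_eq, ← sum_mul_sum, hsq] at hsum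
  rw [sum_congr rfl fun m hm => if_pos hm, sum_congr rfl fun m hm => if_pos hm, ← sq] at hsum
  have hquad : 3 * ∑ u ∈ U, #{m ∈ E | π m u ∈ R m} ≤
      2 * #U + ∑ u ∈ U, #{m ∈ E | π m u ∈ R m} ^ 2 := by
    rw [mul_sum, mul_comm 2, ← smul_eq_mul, ← sum_const, ← sum_add_distrib]
    refine sum_le_sum fun u _ => ?_
    generalize #{m ∈ E | π m u ∈ R m} = t
    rcases t with _ | _ | t <;> nlinarith
  omega

lemma two_mul_pairsCount_le {p : ℕ} [Fact p.Prime] (U : Finset (ZMod p × ZMod p))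
    (m : Option (ZMod p)) :
    2 * (pairsCount p U m : ℚ) ≤
      ∑ c, (#{u ∈ U | dirProj m u = c} : ℚ) * (#{u ∈ U | dirProj m u = c} - 1) := by
  have h : pairsCount p U m ≤ ∑ c, (#{u ∈ U | dirProj m u = c}).choose 2 := by
    rw [pairsCount]
    refine (card_le_card fun s hs => ?_).trans ((card_biUnion_le
      (t := fun c => powersetCard 2 {u ∈ U | dirProj m u = c})).trans_eq
        (sum_congr rfl fun c _ => card_powersetCard _ _))
    obtain ⟨hs, c, hc⟩ := mem_filter.1 hs
    rw [mem_powersetCard] at hs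
    refine mem_biUnion.2 ⟨c, mem_univ _, mem_powersetCard.2 ⟨fun u hu => ?_, hs.2⟩⟩
    exact mem_filter.2 ⟨hs.1 hu, mem_lineWithSlope.1 (hc hu)⟩
  calc 2 * (pairsCount p U m : ℚ)
      ≤ 2 * ∑ c, ((#{u ∈ U | dirProj m u = c}).choose 2 : ℚ) := by
        have : (pairsCount p U m : ℚ) ≤ _ := Nat.cast_le.2 h
        push_cast at this
        gcongr
    _ = _ := by
        rw [mul_sum]
        refine sum_congr rfl fun c _ => ?_
        rw [Nat.cast_choose_two]
        ring

lemma sum_mul_sub_one_le_of_lacunary {ι : Type*} [Fintype ι] {p n r : ℕ} {k : ι → ℕ}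
    (hkp : ∀ c, k c ≤ p) (hw : #{c | n < k c} < n)
    (hlac : ∀ c, (n < k c → p + n ≤ k c + r + #{c | n < k c}) ∧
      (k c ≤ n → k c + #{c | n < k c} ≤ n)) :
    ∑ c, (k c : ℚ) * (k c - 1) ≤ ((n : ℚ) - 1 - #{c | n < k c}) * ∑ c, (k c : ℚ)
      + (2 * p - r - 1) * ∑ c with n < k c, (k c : ℚ)
      - #{c | n < k c} * (p * (p - r) + (n - 1 - #{c | n < k c}) * (p - (r + 1) / 2)) := by
  set w := #{c | n < k c} with hwdef
  have hw' : (w : ℚ) + 1 ≤ n := by exact_mod_cast hw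
  have key : ∀ c, (k c : ℚ) * (k c - 1) ≤ (n - 1 - w) * k c + if n < k c then
      ((2 * p - r - 1) * k c - (p * (p - r) + (n - 1 - w) * (p - (r + 1) / 2)) : ℚ) else 0 := by
    intro c
    have hk0 : (0 : ℚ) ≤ k c := Nat.cast_nonneg _
    split_ifs with h
    · have h1 : (p : ℚ) + n ≤ k c + r + w := by exact_mod_cast (hlac c).1 h
      have h2 : (k c : ℚ) ≤ p := by exact_mod_cast hkp c
      have h3 : 0 ≤ ((p : ℚ) - k c) * (2 * (k c - p + r) - (n - w - 1)) :=
        mul_nonneg (by linarith) (by linarith)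
      have h4 : 0 ≤ ((n : ℚ) - w - 1) * (k c - p + r + 1) :=
        mul_nonneg (by linarith) (by linarith)
      linarith
    · have h1 : (k c : ℚ) + w ≤ n := by exact_mod_cast (hlac c).2 (not_lt.1 h)
      nlinarith
  refine (sum_le_sum fun c _ => key c).trans_eq ?_
  rw [sum_add_distrib, ← mul_sum, ← sum_filter, sum_sub_distrib, ← mul_sum, sum_const,
    nsmul_eq_mul, ← hwdef]
  ring

end Counting

theorem sum_cm_upper_bound (p n r : ℕ) [Fact p.Prime]
    (U : Finset (ZMod p × ZMod p))
    (hn : 1 ≤ n) (hnp : n < p) (hr : r + n < p)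
    (hcard : (U.card : ℤ) = n * p - r)
    (hlines : ¬ ∃ L : Fin n → Option (ZMod p) × ZMod p,
      ∀ u ∈ U, ∃ i : Fin n, u ∈ lineWithSlope p (L i).1 (L i).2)
    (hD : (({m : Option (ZMod p) | IsSpecialDir p U m}.ncard : ℚ))
        ≤ 1 + ((p : ℚ) - r) / (n + 1))
    (f : ℚ → ℚ)
    (hf : ∀ T : ℚ, f T = ((p : ℚ) - r / 2 - 1 / 2) * T ^ 2
        - ((n : ℚ) - 1) * ((p : ℚ) - r / 2 - 1 / 2) * T
        - (p : ℚ) * ((p : ℚ) - r) * T - (U.card : ℚ) * T) :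
    ∑ m ∈ richDirs p U, (pairsCount p U m : ℚ)
      ≤ (((n : ℚ) - 1) * U.card * ((richDirs p U).card : ℚ)
          + (2 * (p : ℚ) - r - 1) * U.card
          + f ((richLines p U).card : ℚ)) / 2 := by
  have hU : #U + r = n * p := by
    zify
    linarith
  have hS : (n + 1) * #{m | IsSpecialDir p U m} + r ≤ p + n + 1 := by
    rw [Set.ncard_eq_toFinset_card' {m | IsSpecialDir p U m}, Set.toFinset_ofPred,
      ← sub_le_iff_le_add', le_div_iff₀ (by positivity)] at hD
    rw [← Nat.cast_le (α := ℚ)]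
    push_cast
    linarith
  set K : Option (ZMod p) → ZMod p → ℕ := fun m c => #{u ∈ U | dirProj m u = c}
  set R : Option (ZMod p) → Finset (ZMod p) := fun m => {c | n < K m c}
  have hrich : ∀ m c, IsRich p U (lineWithSlope p m c) ↔ c ∈ R m := fun m c => by
    simpa [R, K] using isRich_iff (by omega) hU m c
  have hfib : ∀ m, ∑ c, K m c = #U := fun m =>
    (card_eq_sum_card_fiberwise fun _ _ => mem_coe.2 (mem_univ _)).symm
  have hfibR : ∀ m, ∑ c ∈ R m, K m c = #{u ∈ U | dirProj m u ∈ R m} := fun m => by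
    rw [card_eq_sum_card_fiberwise (f := dirProj m) (t := R m)
      fun u hu => mem_coe.2 (mem_filter.1 (mem_coe.1 hu)).2]
    refine sum_congr rfl fun c hc => congrArg card ?_
    rw [filter_filter]
    exact filter_congr fun u _ => ⟨fun h => ⟨by rwa [h], h⟩, fun h => h.2⟩
  have hW : #(richLines p U) = ∑ m ∈ richDirs p U, #(R m) := by
    rw [card_eq_sum_card_fiberwise (f := Prod.fst) (t := richDirs p U)]
    · refine sum_congr rfl fun m _ => ?_
      rw [← card_map (Function.Embedding.sectR m (ZMod p))]
      congr 1
      ext ⟨m', c⟩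
      simp only [richLines, hrich, mem_filter, mem_univ, true_and, mem_map,
        Function.Embedding.sectR_apply, Prod.mk.injEq]
      constructor
      · rintro ⟨h, rfl⟩
        exact ⟨c, h, rfl, rfl⟩
      · rintro ⟨c, h, rfl, rfl⟩
        exact ⟨h, rfl⟩
    · rintro ⟨m, c⟩ h
      rw [mem_coe, richLines, mem_filter] at h
      exact mem_coe.2 (mem_filter.2 ⟨mem_univ _, c, h.2⟩)
  have hinc := two_mul_sum_incidences_le U (richDirs p U) R dirProj
    fun m m' hm u v h h' => eq_of_dirProj_eq hm h h'
  rw [← hW, ← sum_congr rfl fun m _ => hfibR m, ← Nat.cast_le (α := ℚ)] at hinc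
  push_cast at hinc
  have hdir : ∀ m ∈ richDirs p U, 2 * (pairsCount p U m : ℚ) ≤
      ((n : ℚ) - 1) * #U - #(R m) * #U + (2 * p - r - 1) * ∑ c ∈ R m, (K m c : ℚ)
        - (p * (p - r) + (n - 1) * (p - (r + 1) / 2)) * #(R m)
        + (p - (r + 1) / 2) * #(R m) ^ 2 := by
    intro m _
    have h := sum_mul_sub_one_le_of_lacunary (k := K m) (card_filter_dirProj_le U m)
      (card_rich_lt hn hr hU hlines hS m) (card_inter_line_lacunary hn hr hU hS m).2
    rw [← Nat.cast_sum, hfib] at h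
    refine ((two_mul_pairsCount_le U m).trans h).trans_eq ?_
    ring
  have hsum := sum_le_sum hdir
  simp only [sum_add_distrib, sum_sub_distrib, ← mul_sum, ← sum_mul, sum_const, nsmul_eq_mul]
    at hsum
  have hW' : (∑ m ∈ richDirs p U, (#(R m) : ℚ)) = #(richLines p U) := by
    rw [hW]
    push_cast
    rfl
  rw [hW'] at hsum
  have hpr : (0 : ℚ) ≤ 2 * p - r - 1 := by
    have h1 : (r : ℚ) + n < p := by exact_mod_cast hr
    have h2 : (1 : ℚ) ≤ n := by exact_mod_cast hn
    linarith
  have hinc' := mul_le_mul_of_nonneg_left hinc hpr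
  rw [hf]
  linarith
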